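/- arXiv:1502.00433 — 5 statements merged into one kernel-verified Lean document; each statement's English description precedes it below -/
import Mathlib

section
/- Let X be a random variable taking values in a finite set S, let U_S be a uniformly distributed random variable on S, and let Δ = SD(X, U_S) be the statistical distance between X and U_S. Then the collision probability of X satisfies Col(X) ≥ (1 + 4Δ²)/|S|. -/
/-- **Relation between statistical distance and collision probability.**
If `X` is a random variable on a finite set `S` (modeled by its probability mass
function `pr`), `U_S` is uniform on `S`, and `Δ = SD(X, U_S)`, then
`Col(X) ≥ (1 + 4Δ²)/|S|`. -/
theorem col_ge_of_statDist {S : Type*} [Fintype S] [Nonempty S]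
    (pr : S → ℝ) (hpr : ∀ s, 0 ≤ pr s) (hsum : ∑ s, pr s = 1)
    (Δ : ℝ) (hΔ : Δ = (1 / 2) * ∑ s, |pr s - 1 / (Fintype.card S : ℝ)|) :
    (∑ s, (pr s) ^ 2) ≥ (1 + 4 * Δ ^ 2) / (Fintype.card S : ℝ) := by
  have hn : (0 : ℝ) < Fintype.card S := by exact_mod_cast Fintype.card_pos
  have cauchy := sq_sum_le_card_mul_sum_sq (s := Finset.univ)
    (f := fun s => |pr s - 1 / (Fintype.card S : ℝ)|)
  have variance : ∑ s, (pr s - 1 / (Fintype.card S : ℝ)) ^ 2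
      = ∑ s, (pr s) ^ 2 - 1 / (Fintype.card S : ℝ) := by
    simp only [sub_sq, Finset.sum_add_distrib, Finset.sum_sub_distrib, ← Finset.sum_mul,
      ← Finset.mul_sum, hsum, Finset.sum_const, Finset.card_univ, nsmul_eq_mul]
    field_simp
    ring
  simp only [sq_abs, variance, Finset.card_univ, mul_sub, mul_one_div_cancel hn.ne'] at cauchy
  rw [ge_iff_le, div_le_iff₀ hn, hΔ]
  linarith
end

section
/- (Winterhof bound.) Let p be a prime, n ≥ 1, q = pⁿ, let V be an additive subgroup of F_q, and let ψ be a nontrivial additive character of F_q. Then ∑_{a∈F_q} |∑_{x∈V} ψ(a·x)| ≤ q. -/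
/-- The sum of a complex additive character over a finite group is a nonnegative real, so it equals
its own norm. -/
lemma AddChar.ofReal_norm_sum {A : Type*} [AddGroup A] [Fintype A] (χ : AddChar A ℂ) :
    ((‖∑ x, χ x‖ : ℝ) : ℂ) = ∑ x, χ x := by
  classical
  rw [AddChar.sum_eq_ite]
  split_ifs <;> simp

open scoped Classical in
/-- The norms of the sums of the multiplicative shifts of a nontrivial additive character over an
additive subgroup add up to the cardinality of the field. -/
lemma AddChar.sum_norm_sum_addSubgroup {F : Type*} [Field F] [Fintype F] (V : AddSubgroup F)
    {ψ : AddChar F ℂ} (hψ : ψ ≠ 1) :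
    ∑ a : F, ‖∑ x : V, ψ (a * (x : F))‖ = Fintype.card F := by
  have h_norm (a : F) : ((‖∑ x : V, ψ (a * (x : F))‖ : ℝ) : ℂ) = ∑ x : V, ψ (a * (x : F)) :=
    AddChar.ofReal_norm_sum ((ψ.mulShift a).compAddMonoidHom V.subtype)
  apply Complex.ofReal_injective
  push_cast
  simp_rw [h_norm]
  rw [Finset.sum_comm]
  simp [AddChar.sum_mulShift _ (AddChar.IsPrimitive.of_ne_one hψ)]

open scoped Classical in
/-- **Winterhof bound.** Let `q = pⁿ`, `V` an additive subgroup of `F_q`, and `ψ` a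
nontrivial additive character of `F_q`. Then `∑_{a∈F_q} |∑_{x∈V} ψ(a·x)| ≤ q`. -/
theorem winterhof_bound (p n : ℕ) (hp : p.Prime) (hn : 1 ≤ n)
    (F : Type*) [Field F] [Fintype F] (hcard : Fintype.card F = p ^ n)
    (V : AddSubgroup F) (ψ : AddChar F ℂ) (hψ : ψ ≠ 1) :
    ∑ a : F, ‖∑ x : V, ψ (a * (x : F))‖ ≤ (p : ℝ) ^ n := by
  rw [AddChar.sum_norm_sum_addSubgroup V hψ, hcard, Nat.cast_pow]
end

section
/- (Bilinear Vinogradov bound.) Let p be a prime and let G and H be two subsets of F_p*. Then for every integer n with gcd(n,p) = 1, |∑_{x∈G} ∑_{y∈H} e_p(n·x·y)| ≤ (p·|G|·|H|)^{1/2}. -/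
/-- Parseval's identity for the Fourier transform of the indicator function of `H`. -/
theorem sum_norm_sq_sum_addChar {R : Type*} [CommRing R] [Fintype R] [DecidableEq R]
    {ψ : AddChar R ℂ} (hψ : ψ.IsPrimitive) (H : Finset R) :
    ∑ x, ‖∑ y ∈ H, ψ (x * y)‖ ^ 2 = (Fintype.card R : ℝ) * H.card := by
  have key : ∑ x, (∑ y ∈ H, ψ (x * y)) * starRingEnd ℂ (∑ z ∈ H, ψ (x * z)) =
      (Fintype.card R : ℂ) * H.card := by
    calc
      _ = ∑ x, ∑ y ∈ H, ∑ z ∈ H, ψ (x * (y - z)) := by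
        simp only [map_sum, Finset.sum_mul_sum, ← AddChar.map_neg_eq_conj,
          ← AddChar.map_add_eq_mul, sub_eq_add_neg, mul_add, mul_neg]
      _ = ∑ y ∈ H, ∑ z ∈ H, ∑ x, ψ (x * (y - z)) := by
        rw [Finset.sum_comm]
        exact Finset.sum_congr rfl fun _ _ => Finset.sum_comm
      _ = _ := by
        simp [AddChar.sum_mulShift _ hψ, sub_eq_zero, mul_comm]
  simp only [Complex.mul_conj'] at key
  exact_mod_cast key

/-- A bilinear sum of a primitive additive character over `G × H` is at most
`√(|R| * |G| * |H|)` in absolute value. -/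
theorem norm_sum_sum_addChar_le {R : Type*} [CommRing R] [Fintype R] [DecidableEq R]
    {ψ : AddChar R ℂ} (hψ : ψ.IsPrimitive) (G H : Finset R) :
    ‖∑ x ∈ G, ∑ y ∈ H, ψ (x * y)‖ ≤
      Real.sqrt ((Fintype.card R : ℝ) * G.card * H.card) := by
  apply Real.le_sqrt_of_sq_le
  calc
    _ ≤ (∑ x ∈ G, ‖∑ y ∈ H, ψ (x * y)‖) ^ 2 := by gcongr; exact norm_sum_le _ _
    _ ≤ G.card * ∑ x ∈ G, ‖∑ y ∈ H, ψ (x * y)‖ ^ 2 := sq_sum_le_card_mul_sum_sq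
    _ ≤ G.card * ∑ x, ‖∑ y ∈ H, ψ (x * y)‖ ^ 2 := by
      gcongr
      exact Finset.subset_univ G
    _ = _ := by rw [sum_norm_sq_sum_addChar hψ]; ring


/-- **Bilinear Vinogradov bound.** For `p` prime, `G, H ⊆ F_p*` and an integer `n`
coprime to `p`, `|∑_{x∈G} ∑_{y∈H} e_p(n·x·y)| ≤ √(p·|G|·|H|)`. -/
theorem bilinear_vinogradov (p : ℕ) [Fact p.Prime]
    (ep : ZMod p → ℂ)
    (hep : ∀ y : ZMod p, ep y = Complex.exp (2 * Real.pi * Complex.I * (y.val : ℂ) / p))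
    (G H : Finset (ZMod p)) (hG : ∀ x ∈ G, x ≠ 0) (hH : ∀ y ∈ H, y ≠ 0)
    (n : ℤ) (hn : Int.gcd n p = 1) :
    ‖∑ x ∈ G, ∑ y ∈ H, ep ((n : ZMod p) * x * y)‖ ≤
      Real.sqrt ((p : ℝ) * G.card * H.card) := by
  have hn0 : (n : ZMod p) ≠ 0 := by
    intro h
    rw [ZMod.intCast_zmod_eq_zero_iff_dvd] at h
    have h1 := Int.dvd_coe_gcd h dvd_rfl
    rw [hn] at h1
    exact (Fact.out : p.Prime).one_lt.ne' (Nat.dvd_one.mp (by exact_mod_cast h1))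
  have hψ : ((ZMod.stdAddChar (N := p)).mulShift (n : ZMod p)).IsPrimitive :=
    AddChar.IsPrimitive.of_ne_one fun h =>
      hn0 (by_contra fun h0 => ZMod.isPrimitive_stdAddChar p h0 h)
  have h := norm_sum_sum_addChar_le hψ G H
  simpa [AddChar.mulShift_apply, ZMod.stdAddChar_apply, ZMod.toCircle_apply, hep, ZMod.card,
    mul_assoc] using h
end

section
/- Let p be a prime, n ≥ 1, q = pⁿ, let G and H be subsets of F_q*, let ψ be a nontrivial additive character of F_q, and let α : G → ℂ and β : H → ℂ be complex coefficients with |α_x| ≤ 1 for all x ∈ G and |β_y| ≤ 1 for all y ∈ H. Then |∑_{x∈G} ∑_{y∈H} α_x·β_y·ψ(x·y)| ≤ (q·|G|·|H|)^{1/2}. -/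
open scoped ComplexConjugate in
/-- **Parseval's identity** for the sums `∑ y ∈ H, β y * ψ (x * y)`, where `ψ` is a nontrivial
additive character of a finite field. -/
theorem AddChar.sum_norm_sq_sum_mul_apply_mul {F : Type*} [Field F] [Fintype F]
    {ψ : AddChar F ℂ} (hψ : ψ ≠ 1) (H : Finset F) (β : F → ℂ) :
    ∑ x, ‖∑ y ∈ H, β y * ψ (x * y)‖ ^ 2 = Fintype.card F * ∑ y ∈ H, ‖β y‖ ^ 2 := by
  classical
  have hprod (x y z : F) : β y * ψ (x * y) * conj (β z * ψ (x * z)) =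
      β y * conj (β z) * ψ (x * (y - z)) := by
    rw [map_mul conj, ← AddChar.map_neg_eq_conj, mul_sub, sub_eq_add_neg, AddChar.map_add_eq_mul]
    ring
  apply Complex.ofReal_injective
  push_cast
  simp_rw [← Complex.mul_conj', map_sum, Finset.sum_mul_sum, hprod]
  rw [Finset.sum_comm, Finset.mul_sum]
  refine Finset.sum_congr rfl fun y hy ↦ ?_
  rw [Finset.sum_comm]
  simp_rw [← Finset.mul_sum, AddChar.sum_mulShift _ (AddChar.IsPrimitive.of_ne_one hψ),
    sub_eq_zero]
  simp [hy, mul_comm]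


/-- Bilinear character sum bound with bounded complex coefficients over a finite
field `F_q`, `q = pⁿ`: if `ψ` is a nontrivial additive character of `F_q`, `G, H ⊆ F_q*`
and `|α_x| ≤ 1`, `|β_y| ≤ 1`, then `|∑_{x∈G} ∑_{y∈H} α_x β_y ψ(xy)| ≤ √(q·|G|·|H|)`. -/
theorem bilinear_char_sum_coeff_bound (p n : ℕ) (hp : p.Prime) (hn : 1 ≤ n)
    (F : Type*) [Field F] [Fintype F] (hcard : Fintype.card F = p ^ n)
    (G H : Finset F) (hG : ∀ x ∈ G, x ≠ 0) (hH : ∀ y ∈ H, y ≠ 0)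
    (ψ : AddChar F ℂ) (hψ : ψ ≠ 1)
    (α β : F → ℂ) (hα : ∀ x ∈ G, ‖α x‖ ≤ 1) (hβ : ∀ y ∈ H, ‖β y‖ ≤ 1) :
    ‖∑ x ∈ G, ∑ y ∈ H, α x * β y * ψ (x * y)‖ ≤
      Real.sqrt (((p : ℝ) ^ n) * G.card * H.card) := by
  have hnorm : ‖∑ x ∈ G, ∑ y ∈ H, α x * β y * ψ (x * y)‖ ≤
      ∑ x ∈ G, ‖∑ y ∈ H, β y * ψ (x * y)‖ := by
    refine norm_sum_le_of_le _ fun x hx ↦ ?_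
    simp_rw [mul_assoc, ← Finset.mul_sum, norm_mul]
    exact mul_le_of_le_one_left (norm_nonneg _) (hα x hx)
  have hβH : ∑ y ∈ H, ‖β y‖ ^ 2 ≤ H.card := by
    simpa using Finset.sum_le_card_nsmul H _ 1 fun y hy ↦
      pow_le_one₀ (norm_nonneg _) (hβ y hy)
  refine hnorm.trans (Real.le_sqrt_of_sq_le ?_)
  calc (∑ x ∈ G, ‖∑ y ∈ H, β y * ψ (x * y)‖) ^ 2
      ≤ G.card * ∑ x ∈ G, ‖∑ y ∈ H, β y * ψ (x * y)‖ ^ 2 := sq_sum_le_card_mul_sum_sq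
    _ ≤ G.card * ∑ x, ‖∑ y ∈ H, β y * ψ (x * y)‖ ^ 2 := by
      gcongr
      exact G.subset_univ
    _ = G.card * (Fintype.card F * ∑ y ∈ H, ‖β y‖ ^ 2) := by
      rw [AddChar.sum_norm_sq_sum_mul_apply_mul hψ]
    _ ≤ G.card * (Fintype.card F * H.card) := by gcongr
    _ = (p : ℝ) ^ n * G.card * H.card := by
      rw [hcard]
      push_cast
      ring
end

section
/- Let p be an odd prime. Then 2·∑_{a=1}^{(p−1)/2} 1/sin(π·a/p) ≤ p·log₂(p). -/
theorem one_div_sin_pi_mul_div_le {p a : ℝ} (ha : 0 < a) (hap : 2 * a ≤ p) :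
    1 / Real.sin (Real.pi * a / p) ≤ p / 2 * a⁻¹ := by
  have hp : 0 < p := by linarith
  have hpi := Real.pi_pos
  have hle : Real.pi * a / p ≤ Real.pi / 2 := by
    rw [div_le_div_iff₀ hp two_pos]
    nlinarith
  have hsin := Real.mul_le_sin (by positivity) hle
  have heq : 2 / Real.pi * (Real.pi * a / p) = 2 * a / p := by field_simp
  rw [heq] at hsin
  calc 1 / Real.sin (Real.pi * a / p) ≤ 1 / (2 * a / p) :=
        one_div_le_one_div_of_le (by positivity) hsin
    _ = p / 2 * a⁻¹ := by field_simp

theorem harmonic_le_logb_two_mul {n : ℕ} (hn : 1 ≤ n) :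
    (harmonic n : ℝ) ≤ Real.logb 2 (2 * n) := by
  have hn' : (1 : ℝ) ≤ n := by exact_mod_cast hn
  have hlog2 : 0 < Real.log 2 := Real.log_pos one_lt_two
  have hlog : Real.log n ≤ Real.logb 2 n := by
    rw [Real.logb, le_div_iff₀ hlog2]
    exact mul_le_of_le_one_right (Real.log_nonneg hn') (by linarith [Real.log_two_lt_d9])
  rw [Real.logb_mul two_ne_zero (by positivity), Real.logb_self_eq_one one_lt_two]
  linarith [harmonic_le_one_add_log n]

/-- For an odd prime `p`, `2·∑_{a=1}^{(p−1)/2} 1/sin(πa/p) ≤ p·log₂ p`. -/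
theorem sum_inv_sin_bound (p : ℕ) (hp : p.Prime) (hodd : Odd p) :
    2 * ∑ a ∈ Finset.Icc 1 ((p - 1) / 2), 1 / Real.sin (Real.pi * a / p) ≤
      (p : ℝ) * Real.logb 2 p := by
  obtain ⟨n, rfl⟩ := hodd
  have hn : 1 ≤ n := by
    have := hp.two_le
    omega
  have hn' : (1 : ℝ) ≤ n := by exact_mod_cast hn
  rw [show (2 * n + 1 - 1) / 2 = n by omega]
  have hsum : ∑ a ∈ Finset.Icc 1 n, 1 / Real.sin (Real.pi * a / (2 * n + 1 : ℕ)) ≤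
      ((2 * n + 1 : ℕ) : ℝ) / 2 * harmonic n := by
    rw [harmonic_eq_sum_Icc]
    push_cast
    rw [Finset.mul_sum]
    refine Finset.sum_le_sum fun a ha => ?_
    obtain ⟨h1, h2⟩ := Finset.mem_Icc.mp ha
    have h1' : (1 : ℝ) ≤ a := by exact_mod_cast h1
    have h2' : (a : ℝ) ≤ n := by exact_mod_cast h2
    exact one_div_sin_pi_mul_div_le (by linarith) (by linarith)
  have hlogb : Real.logb 2 (2 * n) ≤ Real.logb 2 (2 * n + 1 : ℕ) :=
    Real.logb_le_logb_of_le one_lt_two (by positivity) (by push_cast; linarith)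
  calc _ ≤ 2 * (((2 * n + 1 : ℕ) : ℝ) / 2 * harmonic n) := by gcongr
    _ = ((2 * n + 1 : ℕ) : ℝ) * harmonic n := by ring
    _ ≤ _ := by
      gcongr
      exact (harmonic_le_logb_two_mul hn).trans hlogb
end
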